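/- Downstream messages to honest receivers do not modify adversarial components: let N be a set of adversarial nodes and suppose ⟨S,U,τ⟩ → ⟨S′,U′,τ·m⟩ is a network step delivering a downstream message m = ⟨n,ρ,η,c⟩↓ with receiver n ∉ N. Then the user state of every node in N is unchanged from U to U′, and the server's deniable state satisfies D′(m′) = D(m′) for every node m′ ∈ N; in particular the adversary-visible components of the configuration are unchanged except for the common host components. -/

import Mathlib

/-!
A formalization of the DenIM model: nodes, formal randomness tags, DenIM events,
messages, traces, client/server states, transition rules, indistinguishability
relations (relative to a set of adversarial nodes and a partial bijection on
formal randomness tags), strategy validity, tight bijections, etc.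
-/

namespace DenIM

abbrev Node := ℕ
abbrev Payload := ℕ
abbrev Seed := ℕ
abbrev HostState := ℕ

/-- Formal randomness tags: locally generated `⟨n,g⟩` or seeded `⟨s,c⟩`. -/
inductive Rand
  | loc : Node → ℕ → Rand
  | seeded : Seed → ℕ → Rand
deriving DecidableEq

/-- Symbolic ratchet tokens `⟨n₁,k₁,n₂,k₂,x,y⟩`. -/
structure Token where
  n1 : Node
  k1 : Rand
  n2 : Node
  k2 : Rand
  x : ℕ
  y : ℕ
deriving DecidableEq

/-- DenIM events. Keys `key(r)` are represented by their randomness tag. -/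
inductive Event
  | send : Node → Node → Token → Event
  | fwd : Node → Node → Token → Event
  | refill : Node → Rand → Event
  | kreq : Node → Node → Event
  | kresp : Node → Rand → Node → Event
  | block : Node → Node → Event
  | dummy : Event
deriving DecidableEq

/-- DenIM messages: upstream `⟨n,ρ,η⟩↑` or downstream `⟨n,ρ,η,c⟩↓`. -/
inductive Msg
  | up : Node → Payload → Event → Msg
  | down : Node → Payload → Event → ℕ → Msg
deriving DecidableEq

abbrev Trace := List Msg

/-- Event kinds, the decisions of strategies. -/
inductive Kind
  | send : Node → Kind
  | refill : Kind
  | kreq : Node → Kind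
  | block : Node → Kind
  | dummy : Kind
deriving DecidableEq

/-- A strategy maps a (node-local) trace to an event kind. -/
abbrev Strategy := Trace → Kind

/-- `kind(η)` for upstream events. -/
def eventKind : Event → Option Kind
  | .send _ n2 _ => some (.send n2)
  | .refill _ _ => some .refill
  | .kreq n1 _ => some (.kreq n1)
  | .block n1 _ => some (.block n1)
  | .dummy => some .dummy
  | .fwd _ _ _ => none
  | .kresp _ _ _ => none

/-- `sender(η)`. -/
def eventSender : Event → Option Node
  | .send n1 _ _ => some n1
  | .fwd n1 _ _ => some n1
  | .refill n _ => some n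
  | .kreq _ n2 => some n2
  | .kresp _ _ _ => none
  | .block _ n2 => some n2
  | .dummy => none

/-- The client node designation of a message (sender if upstream, receiver if
downstream). -/
def msgNode : Msg → Node
  | .up n _ _ => n
  | .down n _ _ _ => n

def isUp : Msg → Bool
  | .up _ _ _ => true
  | .down _ _ _ _ => false

/-- Local trace projection `τ|n`: keep a message iff it is upstream with sender
`n` or downstream with receiver `n`. -/
def proj (τ : Trace) (n : Node) : Trace :=
  τ.filter (fun m => msgNode m == n)

inductive Freshness
  | fresh
  | used
deriving DecidableEq

/-- User (signal) state `⟨n,L,M,R,s,c,g⟩`. -/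
structure SignalState where
  node : Node
  L : Set (Rand × Freshness)
  M : Node → Option (Rand × Freshness)
  R : Node → Option (ℕ × Set Rand × Set (ℕ × ℕ))
  seed : Seed
  c : ℕ
  g : ℕ

/-- A user state pairs a strategy with a signal state. -/
structure UserState where
  strat : Strategy
  sig : SignalState

/-- Server-side deniable entry `⟨s,c,K,B,E⟩` for a user. -/
structure DenEntry where
  seed : Seed
  c : ℕ
  K : Set Rand
  B : Set Node
  E : List Event

abbrev DenState := Node → Option DenEntry

/-- Server state `⟨H,Q,D⟩`. -/
structure ServerState where
  H : HostState
  Q : List (Node × Payload)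
  D : DenState

/-- Network configuration `⟨S,U,τ⟩`. -/
structure Config where
  server : ServerState
  users : List UserState
  trace : Trace

/-- Abstract host protocol response function. -/
abbrev ProcessHost := HostState → Node × Payload → HostState × Option (Node × Payload)

/-- Server host step (rules Server-Host-Action / Server-Host-No-Action). -/
def hostStep (ph : ProcessHost) (H : HostState) (Q : List (Node × Payload))
    (γ : Node × Payload) : HostState × List (Node × Payload) :=
  match ph H γ with
  | (H', some γ') => (H', Q ++ [γ'])
  | (H', none) => (H', Q)

/-- Server-side DenIM transitions `D →η D′` (Fig. Server-Denim-*). -/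
inductive ServerDenim : DenState → Event → DenState → Prop
  | refill {D : DenState} {n k s c K B E} :
      D n = some ⟨s, c, K, B, E⟩ →
      ServerDenim D (.refill n k)
        (Function.update D n (some ⟨s, c, K ∪ {k}, B, E⟩))
  | kreq {D : DenState} {n1 n2 s1 c1 K1 B1 E1 s2 c2 K2 B2 E2 k1} :
      D n1 = some ⟨s1, c1, K1, B1, E1⟩ →
      D n2 = some ⟨s2, c2, K2, B2, E2⟩ →
      k1 ∈ K1 →
      ServerDenim D (.kreq n1 n2)
        (Function.update (Function.update D n1 (some ⟨s1, c1, K1 \ {k1}, B1, E1⟩))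
          n2 (some ⟨s2, c2, K2, B2, E2 ++ [.kresp n1 k1 n2]⟩))
  | kreqOutOfKeys {D : DenState} {n1 n2 s1 c1 B1 E1 s2 c2 K2 B2 E2} :
      D n1 = some ⟨s1, c1, ∅, B1, E1⟩ →
      D n2 = some ⟨s2, c2, K2, B2, E2⟩ →
      ServerDenim D (.kreq n1 n2)
        (Function.update (Function.update D n1 (some ⟨s1, c1 + 1, ∅, B1, E1⟩))
          n2 (some ⟨s2, c2, K2, B2, E2 ++ [.kresp n1 (Rand.seeded s1 c1) n2]⟩))
  | send {D : DenState} {n1 n2 tok s c K B E} :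
      D n2 = some ⟨s, c, K, B, E⟩ →
      n1 ∉ B →
      ServerDenim D (.send n1 n2 tok)
        (Function.update D n2 (some ⟨s, c, K, B, E ++ [.fwd n1 n2 tok]⟩))
  | sendBlockedOrUnregistered {D : DenState} {n1 n2 tok} :
      ((∃ s c K B E, D n2 = some (⟨s, c, K, B, E⟩ : DenEntry) ∧ n1 ∈ B) ∨ D n2 = none) →
      ServerDenim D (.send n1 n2 tok) D
  | block {D : DenState} {n1 n2 s c K B E} :
      D n2 = some ⟨s, c, K, B, E⟩ →
      ServerDenim D (.block n1 n2)
        (Function.update D n2 (some ⟨s, c, K, B ∪ {n1}, E⟩))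

/-- Client downstream DenIM transitions (Fig. User-Denim-Kresp / Fwd-*). -/
inductive UserDown : SignalState → Event → SignalState → Prop
  | kresp {χ : SignalState} {n1 k} :
      UserDown χ (.kresp n1 k χ.node)
        { χ with M := Function.update χ.M n1 (some (k, .fresh)) }
  | fwdNewSession {χ : SignalState} {n1 k1 k y} :
      χ.R n1 = none →
      (k, Freshness.fresh) ∈ χ.L →
      UserDown χ (.fwd n1 χ.node ⟨n1, k1, χ.node, k, 0, y⟩)
        { χ with
          L := (χ.L \ {(k, Freshness.fresh)}) ∪ {(k, Freshness.used)},
          R := Function.update χ.R n1 (some (1, {k, k1}, {(0, y)})) }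
  | fwdInitialized {χ : SignalState} {n1 k1 k x y ι I} :
      χ.R n1 = some (ι, {k, k1}, I) →
      UserDown χ (.fwd n1 χ.node ⟨n1, k1, χ.node, k, x, y⟩)
        { χ with R := Function.update χ.R n1 (some (ι, {k, k1}, I ∪ {(x, y)})) }

/-- The latest index pair of a ratchet (lexicographic maximum). -/
def IsLatest (I : Set (ℕ × ℕ)) (p : ℕ × ℕ) : Prop :=
  p ∈ I ∧ ∀ q ∈ I, q.1 < p.1 ∨ (q.1 = p.1 ∧ q.2 ≤ p.2)

/-- The `next` coordinates of a ratchet with first index `ι`. -/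
def NextCoord (ι : ℕ) (I : Set (ℕ × ℕ)) (p : ℕ × ℕ) : Prop :=
  ∃ xl yl, IsLatest I (xl, yl) ∧
    p = if xl % 2 = ι then (xl, yl + 1) else (xl + 1, 0)

/-- Client upstream DenIM transitions (Fig. User-Denim-Refill / Kreq / Block /
Send-New-Session / Send-Initialized). -/
inductive UserUp : SignalState → Event → SignalState → Prop
  | refill {χ : SignalState} :
      UserUp χ (.refill χ.node (Rand.loc χ.node χ.g))
        { χ with L := χ.L ∪ {(Rand.loc χ.node χ.g, Freshness.fresh)}, g := χ.g + 1 }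
  | kreq {χ : SignalState} {n1} :
      UserUp χ (.kreq n1 χ.node) χ
  | block {χ : SignalState} {n1} :
      UserUp χ (.block n1 χ.node) χ
  | sendNewSession {χ : SignalState} {n1 k1} :
      χ.R n1 = none →
      χ.M n1 = some (k1, Freshness.fresh) →
      UserUp χ (.send χ.node n1 ⟨χ.node, Rand.loc χ.node χ.g, n1, k1, 0, 0⟩)
        { χ with
          L := χ.L ∪ {(Rand.loc χ.node χ.g, Freshness.used)},
          M := Function.update χ.M n1 (some (k1, Freshness.used)),
          R := Function.update χ.R n1 (some (0, {Rand.loc χ.node χ.g, k1}, {(0, 0)})),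
          g := χ.g + 1 }
  | sendInitialized {χ : SignalState} {n1 k k1 ι I x y} :
      χ.R n1 = some (ι, {k, k1}, I) →
      NextCoord ι I (x, y) →
      (k, Freshness.used) ∈ χ.L →
      UserUp χ (.send χ.node n1 ⟨χ.node, k, n1, k1, x, y⟩)
        { χ with R := Function.update χ.R n1 (some (ι, {k, k1}, I ∪ {(x, y)})) }

/-- Seeded (deterministic) key generation `gen(s,c,c′)`. -/
def detKeyGen (s : Seed) (c c' : ℕ) : Set (Rand × Freshness) :=
  { p | ∃ j, c ≤ j ∧ j < c' ∧ p = (Rand.seeded s j, Freshness.fresh) }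

/-- Auxiliary user transitions (Fig. Aux-Upstream-User-* / Aux-Downstream-User-*). -/
inductive UserAux : UserState → Trace → Msg → UserState → Prop
  | upEvent {u : UserState} {τ η ρ χ' κ} :
      UserUp u.sig η χ' →
      eventKind η = some κ →
      u.strat (proj τ u.sig.node) = κ →
      UserAux u τ (.up u.sig.node ρ η) ⟨u.strat, χ'⟩
  | upDummy {u : UserState} {τ ρ} :
      u.strat (proj τ u.sig.node) = .dummy →
      UserAux u τ (.up u.sig.node ρ .dummy) u
  | downEvent {u : UserState} {τ ρ η c' χ'} :
      UserDown { u.sig with L := u.sig.L ∪ detKeyGen u.sig.seed u.sig.c c', c := c' } η χ' →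
      UserAux u τ (.down u.sig.node ρ η c') ⟨u.strat, χ'⟩
  | downDummyOrMalformed {u : UserState} {τ ρ η c'} :
      (∀ χ', ¬ UserDown { u.sig with L := u.sig.L ∪ detKeyGen u.sig.seed u.sig.c c',
                                     c := c' } η χ') →
      UserAux u τ (.down u.sig.node ρ η c')
        ⟨u.strat, { u.sig with L := u.sig.L ∪ detKeyGen u.sig.seed u.sig.c c', c := c' }⟩

/-- Auxiliary server transitions (Fig. Aux-Upstream-Server-* / Aux-Downstream-Server-*). -/
inductive ServerAux (ph : ProcessHost) : ServerState → Msg → ServerState → Prop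
  | upEvent {S : ServerState} {n ρ η D'} :
      ServerDenim S.D η D' →
      ServerAux ph S (.up n ρ η)
        ⟨(hostStep ph S.H S.Q (n, ρ)).1, (hostStep ph S.H S.Q (n, ρ)).2, D'⟩
  | upDummyOrMalformed {S : ServerState} {n ρ η} :
      (∀ D', ¬ ServerDenim S.D η D') →
      ServerAux ph S (.up n ρ η)
        ⟨(hostStep ph S.H S.Q (n, ρ)).1, (hostStep ph S.H S.Q (n, ρ)).2, S.D⟩
  | downEvent {H : HostState} {n ρ Q D s c K B η E} :
      D n = some ⟨s, c, K, B, η :: E⟩ →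
      ServerAux ph ⟨H, (n, ρ) :: Q, D⟩ (.down n ρ η c)
        ⟨H, Q, Function.update D n (some ⟨s, c, K, B, E⟩)⟩
  | downDummy {H : HostState} {n ρ Q D s c K B} :
      D n = some ⟨s, c, K, B, ([] : List Event)⟩ →
      ServerAux ph ⟨H, (n, ρ) :: Q, D⟩ (.down n ρ .dummy c) ⟨H, Q, D⟩

/-- The global network transition relation (rule Net-Global). -/
inductive NetStep (ph : ProcessHost) : Config → Config → Prop
  | step {S S' : ServerState} {U1 U2 : List UserState} {u u' : UserState} {τ : Trace} {m : Msg} :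
      UserAux u τ m u' →
      ServerAux ph S m S' →
      NetStep ph ⟨S, U1 ++ u :: U2, τ⟩ ⟨S', U1 ++ u' :: U2, τ ++ [m]⟩

/-! ## Partial bijections on formal randomness tags -/

/-- A (partial) bijection on formal randomness tags. -/
structure PBij where
  toFun : Rand → Option Rand
  inj : ∀ a b r, toFun a = some r → toFun b = some r → a = b

def PBij.Dom (π : PBij) : Set Rand := { r | π.toFun r ≠ none }

def PBij.Img (π : PBij) : Set Rand := { r' | ∃ r, π.toFun r = some r' }

/-- The empty bijection. -/
def emptyPBij : PBij :=
  ⟨fun _ => none, by intro a b r h; simp at h⟩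

/-- `π ⊑ π′`: the bijection `π′` extends `π`. -/
def PBij.Sub (π π' : PBij) : Prop :=
  ∀ a b, π.toFun a = some b → π'.toFun a = some b

/-- `r` is related to `r′` by `π`. -/
def REq (π : PBij) (r r' : Rand) : Prop := π.toFun r = some r'

/-! ## Indistinguishability -/

def TokEq (π : PBij) (t1 t2 : Token) : Prop :=
  t1.n1 = t2.n1 ∧ t1.n2 = t2.n2 ∧ t1.x = t2.x ∧ t1.y = t2.y ∧
  REq π t1.k1 t2.k1 ∧ REq π t1.k2 t2.k2

/-- Event indistinguishability `η₁ ≈^π η₂`. -/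
inductive EvEq (π : PBij) : Event → Event → Prop
  | block {n1 n2} : EvEq π (.block n1 n2) (.block n1 n2)
  | kreq {n1 n2} : EvEq π (.kreq n1 n2) (.kreq n1 n2)
  | dummy : EvEq π .dummy .dummy
  | send {n1 n2 t1 t2} : TokEq π t1 t2 → EvEq π (.send n1 n2 t1) (.send n1 n2 t2)
  | fwd {n1 n2 t1 t2} : TokEq π t1 t2 → EvEq π (.fwd n1 n2 t1) (.fwd n1 n2 t2)
  | refill {n r r'} : REq π r r' → EvEq π (.refill n r) (.refill n r')
  | kresp {n1 n2 r r'} : REq π r r' → EvEq π (.kresp n1 r n2) (.kresp n1 r' n2)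

/-- Message indistinguishability `m₁ ≈_N^π m₂`. -/
inductive MsgEq (N : Set Node) (π : PBij) : Msg → Msg → Prop
  | up {n ρ η1 η2} :
      (n ∈ N → EvEq π η1 η2) →
      MsgEq N π (.up n ρ η1) (.up n ρ η2)
  | down {n ρ η1 η2 c1 c2} :
      (n ∈ N → EvEq π η1 η2 ∧ c1 = c2) →
      MsgEq N π (.down n ρ η1 c1) (.down n ρ η2 c2)

/-- Trace indistinguishability `τ₁ ≈_N^π τ₂`: equal length and pointwise. -/
def TraceEq (N : Set Node) (π : PBij) (τ1 τ2 : Trace) : Prop :=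
  List.Forall₂ (MsgEq N π) τ1 τ2

def KSetEq (π : PBij) (K1 K2 : Set Rand) : Prop :=
  (∀ r ∈ K1, ∃ r', REq π r r' ∧ r' ∈ K2) ∧ (∀ r' ∈ K2, ∃ r, REq π r r' ∧ r ∈ K1)

def LSetEq (π : PBij) (L1 L2 : Set (Rand × Freshness)) : Prop :=
  (∀ r f, (r, f) ∈ L1 → ∃ r', REq π r r' ∧ (r', f) ∈ L2) ∧
  (∀ r' f, (r', f) ∈ L2 → ∃ r, REq π r r' ∧ (r, f) ∈ L1)

def MEq (π : PBij) (M1 M2 : Node → Option (Rand × Freshness)) : Prop :=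
  ∀ n, (M1 n = none ↔ M2 n = none) ∧
    (∀ r f, M1 n = some (r, f) → ∃ r', REq π r r' ∧ M2 n = some (r', f))

def RatEq (π : PBij) (R1 R2 : Node → Option (ℕ × Set Rand × Set (ℕ × ℕ))) : Prop :=
  ∀ n, (R1 n = none ↔ R2 n = none) ∧
    (∀ ι K1 I, R1 n = some (ι, K1, I) → ∃ K2, KSetEq π K1 K2 ∧ R2 n = some (ι, K2, I))

/-- User state indistinguishability. -/
def UserEq (N : Set Node) (π : PBij) (u1 u2 : UserState) : Prop :=
  u1.sig.node = u2.sig.node ∧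
  (u1.sig.node ∈ N →
    u1.strat = u2.strat ∧
    u1.sig.seed = u2.sig.seed ∧ u1.sig.c = u2.sig.c ∧ u1.sig.g = u2.sig.g ∧
    LSetEq π u1.sig.L u2.sig.L ∧ MEq π u1.sig.M u2.sig.M ∧ RatEq π u1.sig.R u2.sig.R)

/-- Server user configuration indistinguishability. -/
def EntryEq (π : PBij) (e1 e2 : DenEntry) : Prop :=
  e1.seed = e2.seed ∧ e1.c = e2.c ∧ e1.B = e2.B ∧
  KSetEq π e1.K e2.K ∧ List.Forall₂ (EvEq π) e1.E e2.E

def OptEntryEq (π : PBij) : Option DenEntry → Option DenEntry → Prop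
  | none, none => True
  | some e1, some e2 => EntryEq π e1 e2
  | _, _ => False

/-- System configuration indistinguishability `C₁ ≈_N^π C₂`. -/
def ConfigEq (N : Set Node) (π : PBij) (C1 C2 : Config) : Prop :=
  C1.server.H = C2.server.H ∧
  C1.server.Q = C2.server.Q ∧
  (∀ n ∈ N, OptEntryEq π (C1.server.D n) (C2.server.D n)) ∧
  List.Forall₂ (UserEq N π) C1.users C2.users ∧
  TraceEq N π C1.trace C2.trace

/-! ## Strategy validity -/

/-- Send well-formedness of a strategy of node `n`. -/
def SendWF (n : Node) (σ : Strategy) : Prop :=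
  ∀ τ nd, σ τ = .send nd →
    ∃ m ∈ τ, (∃ ρ k c, m = Msg.down n ρ (.kresp nd k n) c) ∨
             (∃ ρ tok c, m = Msg.down n ρ (.fwd nd n tok) c)

/-- DenIM send validity w.r.t. the adversarial nodes `N`. -/
def SendValid (N : Set Node) (σ : Strategy) : Prop :=
  ∀ τ nd, (σ τ = .send nd ∨ σ τ = .kreq nd) → nd ∉ N

/-- Determinism w.r.t. formal randomness. -/
def DetRand (σ : Strategy) : Prop :=
  ∀ (N : Set Node) (π : PBij) (τ1 τ2 : Trace), TraceEq N π τ1 τ2 → σ τ1 = σ τ2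

/-- A strategy of node `n` valid w.r.t. `N`. -/
def ValidStrategy (N : Set Node) (n : Node) (σ : Strategy) : Prop :=
  SendWF n σ ∧ SendValid N σ ∧ DetRand σ

/-- A user collection is valid if every non-adversarial node's strategy is valid. -/
def ValidUsers (N : Set Node) (U : List UserState) : Prop :=
  ∀ u ∈ U, u.sig.node ∉ N → ValidStrategy N u.sig.node u.strat

/-- Valid destinations of a signal configuration: `dom M ∪ dom R`. -/
def dests (χ : SignalState) : Set Node :=
  { n | χ.M n ≠ none } ∪ { n | χ.R n ≠ none }

/-- A trace is consistent with valid destinations for the users in `U`. -/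
def ConsistentDests (N : Set Node) (U : List UserState) (τ : Trace) : Prop :=
  ∀ u ∈ U, ∀ σ : Strategy, ValidStrategy N u.sig.node σ →
    ∀ nd, σ (proj τ u.sig.node) = .send nd → nd ∈ dests u.sig

/-- A message valid w.r.t. `N`: upstream messages of honest nodes only
send/request keys of honest destinations. -/
def ValidMsg (N : Set Node) (m : Msg) : Prop :=
  ∀ n ρ η, m = Msg.up n ρ η → n ∉ N →
    ((∀ n1 n2 tok, η = Event.send n1 n2 tok → n2 ∉ N) ∧
     (∀ n1 n2, η = Event.kreq n1 n2 → n1 ∉ N))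

/-! ## Tags appearing in adversarial components, tight bijections -/

def tagsOfEvent : Event → Set Rand
  | .send _ _ t => {t.k1, t.k2}
  | .fwd _ _ t => {t.k1, t.k2}
  | .refill _ k => {k}
  | .kresp _ k _ => {k}
  | .kreq _ _ => ∅
  | .block _ _ => ∅
  | .dummy => ∅

def tagsOfMsg : Msg → Set Rand
  | .up _ _ η => tagsOfEvent η
  | .down _ _ η _ => tagsOfEvent η

def tagsOfEntry (e : DenEntry) : Set Rand :=
  e.K ∪ { r | ∃ η ∈ e.E, r ∈ tagsOfEvent η }

def tagsOfSig (χ : SignalState) : Set Rand :=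
  { r | ∃ f, (r, f) ∈ χ.L } ∪
  { r | ∃ n f, χ.M n = some (r, f) } ∪
  { r | ∃ n ι K I, χ.R n = some (ι, K, I) ∧ r ∈ K }

/-- The formal randomness tags appearing in the adversarial components of a
configuration. -/
def AdvTags (N : Set Node) (C : Config) : Set Rand :=
  { r | ∃ n ∈ N, ∃ e, C.server.D n = some e ∧ r ∈ tagsOfEntry e } ∪
  { r | ∃ u ∈ C.users, u.sig.node ∈ N ∧ r ∈ tagsOfSig u.sig } ∪
  { r | ∃ m ∈ C.trace, msgNode m ∈ N ∧ r ∈ tagsOfMsg m }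

/-- `π` is tight w.r.t. configurations `C₁`, `C₂` and adversarial nodes `N`. -/
def Tight (N : Set Node) (π : PBij) (C1 C2 : Config) : Prop :=
  π.Dom ⊆ AdvTags N C1 ∧ π.Img ⊆ AdvTags N C2


/-- A downstream message only affects a user state whose node is the receiver. -/
theorem UserAux.node_eq_of_down {u u' : UserState} {τ : Trace} {n : Node} {ρ : Payload}
    {η : Event} {c : ℕ} (h : UserAux u τ (.down n ρ η c) u') : u.sig.node = n := by
  cases h <;> rfl

/-- A downstream message only affects the deniable entry of its receiver. -/
theorem ServerAux.deniable_eq_of_down {ph : ProcessHost} {S S' : ServerState} {n m : Node}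
    {ρ : Payload} {η : Event} {c : ℕ} (h : ServerAux ph S (.down n ρ η c) S') (hm : m ≠ n) :
    S'.D m = S.D m := by
  cases h with
  | downEvent _ => exact Function.update_of_ne hm _ _
  | downDummy _ => rfl

/-- Downstream messages to honest receivers do not modify adversarial
components: if a network step delivers a downstream message
`m = ⟨n,ρ,η,c⟩↓` with `n ∉ N`, then the user states of all nodes in `N` are
unchanged and the server's deniable entries of all nodes in `N` are unchanged
(only the common host components may change). -/
theorem downstream_honest_preserves_adv (ph : ProcessHost) (N : Set Node)
    (S S' : ServerState) (U U' : List UserState) (τ : Trace)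
    (n : Node) (hn : n ∉ N) (ρ : Payload) (η : Event) (c : ℕ)
    (hstep : NetStep ph ⟨S, U, τ⟩ ⟨S', U', τ ++ [Msg.down n ρ η c]⟩) :
    List.Forall₂ (fun u u' => u.sig.node ∈ N → u = u') U U' ∧
    ∀ m ∈ N, S'.D m = S.D m := by
  generalize hC : (⟨S, U, τ⟩ : Config) = C at hstep
  generalize hC' : (⟨S', U', τ ++ [Msg.down n ρ η c]⟩ : Config) = C' at hstep
  cases hstep with
  | step hu hs =>
    injection hC with hS hU hτ
    injection hC' with hS' hU' hτ'
    subst hS hU hτ hS' hU'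
    obtain rfl := List.singleton_injective (List.append_cancel_left hτ')
    refine ⟨List.rel_append (List.forall₂_same.2 fun _ _ _ => rfl)
      (.cons (fun hN => absurd (hu.node_eq_of_down ▸ hN) hn)
        (List.forall₂_same.2 fun _ _ _ => rfl)), fun m hm => ?_⟩
    exact hs.deniable_eq_of_down fun h => hn (h ▸ hm)

end DenIM
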